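/- arXiv:1606.08883 — 3 statements merged into one kernel-verified Lean document; each statement's English description precedes it below -/
import Mathlib

section
/- Tverberg's theorem: Let m and f be nonnegative integers, and let Y be a finite family (multiset) of at least (m+1)f+1 points in ℝ^m. Then the index set of Y can be partitioned into f+1 nonempty parts Y_1, …, Y_{f+1} such that the intersection of the convex hulls of the corresponding point sets is nonempty, i.e. ⋂_{i=1}^{f+1} conv(Y_i) ≠ ∅. -/
open scoped RealInnerProductSpace

/-- If `p` has minimal norm on the segment from `p` to `q`, then `q` lies in the half-space
bounded by the hyperplane through `p` orthogonal to `p`, on the side away from `0`. -/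
lemma norm_sq_le_inner_of_forall_segment {E : Type*} [NormedAddCommGroup E]
    [InnerProductSpace ℝ E] {p q : E} (h : ∀ x ∈ segment ℝ p q, ‖p‖ ≤ ‖x‖) :
    ‖p‖ ^ 2 ≤ ⟪p, q⟫ := by
  by_contra! hlt
  set s := ‖p‖ ^ 2 - ⟪p, q⟫ with hs
  have hs0 : 0 < s := by linarith
  set D := ‖q - p‖ ^ 2 with hD
  have hD0 : 0 ≤ D := by positivity
  set t := s / (s + D) with ht
  have ht0 : 0 < t := by positivity
  have ht1 : t ≤ 1 := by rw [ht, div_le_one (by positivity)]; linarith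
  have hts : t * (s + D) = s := by rw [ht]; field_simp
  have hx : p + t • (q - p) ∈ segment ℝ p q := by
    rw [segment_eq_image']
    exact ⟨t, ⟨ht0.le, ht1⟩, rfl⟩
  have hsq : ‖p‖ ^ 2 ≤ ‖p + t • (q - p)‖ ^ 2 := by
    have := h _ hx
    gcongr
  rw [norm_add_sq_real, inner_smul_right, inner_sub_right, real_inner_self_eq_norm_sq,
    norm_smul, mul_pow, Real.norm_eq_abs, sq_abs, ← hD] at hsq
  nlinarith [mul_pos ht0 hs0, mul_pos ht0 (mul_pos ht0 hs0)]

/-- A point `p ≠ 0` of the convex hull of `x` which minimizes the inner product with `p` is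
already in the convex hull of `x` with one index removed, provided the number of indices exceeds
the dimension. -/
lemma exists_mem_convexHull_image_compl {E κ : Type*} [NormedAddCommGroup E]
    [InnerProductSpace ℝ E] [FiniteDimensional ℝ E] [Fintype κ]
    (hκ : Module.finrank ℝ E < Fintype.card κ) {x : κ → E} {p : E} (hp0 : p ≠ 0)
    (hp : p ∈ convexHull ℝ (Set.range x)) (hx : ∀ k, ‖p‖ ^ 2 ≤ ⟪p, x k⟫) :
    ∃ k, p ∈ convexHull ℝ (x '' {k}ᶜ) := by
  classical
  obtain ⟨ι, _, z, w, hz, hind, hw, hw1, hzp⟩ := eq_pos_convex_span_of_mem_convexHull hp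
  have hpp : 0 < ‖p‖ ^ 2 := by positivity
  have hzx : ∀ i, ‖p‖ ^ 2 ≤ ⟪p, z i⟫ := fun i => by
    obtain ⟨k, hk⟩ := hz ⟨i, rfl⟩
    exact hk ▸ hx k
  have hzeq : ∀ i, ⟪p, z i⟫ = ‖p‖ ^ 2 := by
    have hsum : ∑ i, w i * (⟪p, z i⟫ - ‖p‖ ^ 2) = 0 := by
      simp only [mul_sub, Finset.sum_sub_distrib, ← Finset.sum_mul, hw1, one_mul,
        ← real_inner_smul_right, ← inner_sum, hzp, real_inner_self_eq_norm_sq, sub_self]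
    rw [Finset.sum_eq_zero_iff_of_nonneg
      fun i _ => mul_nonneg (hw i).le (sub_nonneg.2 (hzx i))] at hsum
    intro i
    have := (mul_eq_zero.1 (hsum i (Finset.mem_univ i))).resolve_left (hw i).ne'
    linarith
  have hlin : LinearIndependent ℝ z := by
    rw [Fintype.linearIndependent_iff]
    intro a ha i
    have hinner : (∑ i, a i) * ‖p‖ ^ 2 = 0 := by
      rw [← inner_zero_right (𝕜 := ℝ) p, ← ha, inner_sum, Finset.sum_mul]
      simp only [real_inner_smul_right, hzeq]
    exact affineIndependent_iff.1 hind Finset.univ a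
      ((mul_eq_zero.1 hinner).resolve_right hpp.ne') ha i (Finset.mem_univ i)
  choose σ hσ using fun i => hz ⟨i, rfl⟩
  obtain ⟨k, hk⟩ : ∃ k, ∀ i, σ i ≠ k := by
    by_contra! hsurj
    exact absurd (Fintype.card_le_of_surjective σ hsurj)
      (not_le.2 (hlin.fintype_card_le_finrank.trans_lt hκ))
  refine ⟨k, hzp ▸ (convex_convexHull ℝ _).sum_mem (fun i _ => (hw i).le) hw1 fun i _ => ?_⟩
  exact subset_convexHull ℝ _ ⟨σ i, hk i, hσ i⟩

/-- **Bárány's colorful Carathéodory theorem**: if `0` is in the convex hull of each of more than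
`dim E` finite color classes, then it is in the convex hull of a rainbow selection. -/
theorem exists_zero_mem_convexHull_range_rainbow {E κ ι : Type*} [NormedAddCommGroup E]
    [InnerProductSpace ℝ E] [FiniteDimensional ℝ E] [Fintype κ] [Finite ι] [Nonempty ι]
    (hκ : Module.finrank ℝ E < Fintype.card κ) (c : κ → ι → E)
    (hc : ∀ k, (0 : E) ∈ convexHull ℝ (Set.range (c k))) :
    ∃ g : κ → ι, (0 : E) ∈ convexHull ℝ (Set.range fun k => c k (g k)) := by
  classical
  let K : Set E := ⋃ g : κ → ι, convexHull ℝ (Set.range fun k => c k (g k))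
  have hKc : IsCompact K := isCompact_iUnion fun g => (Set.finite_range _).isCompact_convexHull ℝ
  have : Nonempty κ := Fintype.card_pos_iff.1 (by omega)
  have hKne : K.Nonempty := by
    obtain ⟨g⟩ : Nonempty (κ → ι) := inferInstance
    exact Set.nonempty_iUnion.2 ⟨g, (Set.range_nonempty _).convexHull⟩
  obtain ⟨p, hpK, hmin⟩ := hKc.exists_isMinOn hKne continuous_norm.continuousOn
  obtain ⟨g, hg⟩ := Set.mem_iUnion.1 hpK
  refine ⟨g, ?_⟩
  by_cases hp0 : p = 0
  · exact hp0 ▸ hg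
  exfalso
  have key : ∀ (g' : κ → ι) (q : E), p ∈ convexHull ℝ (Set.range fun k => c k (g' k)) →
      q ∈ convexHull ℝ (Set.range fun k => c k (g' k)) → ‖p‖ ^ 2 ≤ ⟪p, q⟫ :=
    fun g' q hp hq => norm_sq_le_inner_of_forall_segment fun x hx =>
      hmin (Set.mem_iUnion.2 ⟨g', (convex_convexHull ℝ _).segment_subset hp hq hx⟩)
  obtain ⟨k, hk⟩ := exists_mem_convexHull_image_compl hκ hp0 hg
    fun k => key g _ hg (subset_convexHull ℝ _ ⟨k, rfl⟩)
  have hhalf : ∀ j, ‖p‖ ^ 2 ≤ ⟪p, c k j⟫ := fun j => by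
    refine key (Function.update g k j) _ (convexHull_mono ?_ hk)
      (subset_convexHull ℝ _ ⟨k, by simp⟩)
    rintro _ ⟨l, hl, rfl⟩
    exact ⟨l, by simp [Function.update_of_ne hl]⟩
  have hzero : (0 : E) ∈ {q : E | ‖p‖ ^ 2 ≤ ⟪p, q⟫} :=
    convexHull_min (t := {q : E | ‖p‖ ^ 2 ≤ ⟪p, q⟫}) (Set.range_subset_iff.2 hhalf)
      (convex_halfSpace_ge (innerₗ E p).isLinear _) (hc k)
  have hpp : 0 < ‖p‖ ^ 2 := by positivity
  simp only [Set.mem_ofPred_eq, inner_zero_right] at hzero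
  linarith

/-- The vectors `e₀, …, e_{f-1}, -(e₀ + ⋯ + e_{f-1})` of `ℝ^f`. -/
def simplexVector (f : ℕ) (j : Fin (f + 1)) (a : Fin f) : ℝ :=
  (if j = a.castSucc then 1 else 0) - (if j = Fin.last f then 1 else 0)

lemma sum_mul_simplexVector (f : ℕ) (X : Fin (f + 1) → ℝ) (a : Fin f) :
    ∑ j, X j * simplexVector f j a = X a.castSucc - X (Fin.last f) := by
  simp [simplexVector, mul_sub, Finset.sum_sub_distrib]

/-- Sarkaria's tensor trick: weights on the points whose restrictions to the parts of a suitable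
labelling all have the same total mass and the same first moment. -/
lemma exists_balanced_weights {κ : Type*} [Fintype κ] (m f : ℕ)
    (hκ : (m + 1) * f < Fintype.card κ) (y : κ → Fin m → ℝ) :
    ∃ (g : κ → Fin (f + 1)) (w : κ → ℝ), (∀ k, 0 ≤ w k) ∧ ∑ k, w k = 1 ∧
      (∀ j, ∑ k with g k = j, w k = ∑ k with g k = Fin.last f, w k) ∧
      ∀ j, ∑ k with g k = j, w k • y k = ∑ k with g k = Fin.last f, w k • y k := by
  classical
  let lift : κ → Option (Fin m) → ℝ := fun k b => b.elim 1 (y k)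
  let c : κ → Fin (f + 1) → EuclideanSpace ℝ (Option (Fin m) × Fin f) := fun k j =>
    WithLp.toLp 2 fun ba => lift k ba.1 * simplexVector f j ba.2
  have hc : ∀ k, (0 : EuclideanSpace ℝ (Option (Fin m) × Fin f)) ∈
      convexHull ℝ (Set.range (c k)) := fun k => by
    have hsum : ∑ j, (1 / (f + 1 : ℝ)) • c k j = 0 := by
      rw [← Finset.smul_sum]
      convert smul_zero _
      ext ba
      simp only [c, WithLp.ofLp_sum, Finset.sum_apply, WithLp.ofLp_zero, Pi.zero_apply]
      rw [sum_mul_simplexVector f (fun _ => lift k ba.1), sub_self]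
    rw [← hsum]
    refine (convex_convexHull ℝ _).sum_mem (fun j _ => by positivity) ?_
      fun j _ => subset_convexHull ℝ _ ⟨j, rfl⟩
    simp [mul_inv_cancel₀ (Nat.cast_add_one_ne_zero f : (f + 1 : ℝ) ≠ 0)]
  obtain ⟨g, hg⟩ := exists_zero_mem_convexHull_range_rainbow (by simpa using hκ) c hc
  rw [convexHull_range_eq_exists_affineCombination] at hg
  obtain ⟨s, u, hu, hu1, hsum⟩ := hg
  rw [Finset.affineCombination_eq_linear_combination s _ u hu1] at hsum
  let w : κ → ℝ := fun k => if k ∈ s then u k else 0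
  have hbal : ∀ b j, ∑ k with g k = j, w k * lift k b =
      ∑ k with g k = Fin.last f, w k * lift k b := fun b j => by
    induction j using Fin.lastCases with
    | last => rfl
    | cast a =>
      rw [← sub_eq_zero, ← sum_mul_simplexVector f (fun j => ∑ k with g k = j, w k * lift k b)]
      have hcoord := congrArg (fun z => z.ofLp (b, a)) hsum
      simp only [c, WithLp.ofLp_sum, WithLp.ofLp_smul, Finset.sum_apply, Pi.smul_apply,
        WithLp.ofLp_zero, Pi.zero_apply, smul_eq_mul] at hcoord
      calc ∑ j, (∑ k with g k = j, w k * lift k b) * simplexVector f j a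
          = ∑ j, ∑ k with g k = j, w k * lift k b * simplexVector f (g k) a := by
            refine Finset.sum_congr rfl fun j _ => ?_
            rw [Finset.sum_mul]
            refine Finset.sum_congr rfl fun k hk => ?_
            rw [(Finset.mem_filter.1 hk).2]
        _ = ∑ k, w k * lift k b * simplexVector f (g k) a := Finset.sum_fiberwise _ _ _
        _ = ∑ k ∈ s, u k * (lift k b * simplexVector f (g k) a) := by
            simp [w, mul_assoc, ite_mul]
        _ = 0 := hcoord
  refine ⟨g, w, fun k => ?_, by simpa [w] using hu1, fun j => ?_, fun j => ?_⟩
  · by_cases hk : k ∈ s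
    · simpa [w, hk] using hu k hk
    · simp [w, hk]
  · simpa [lift] using hbal none j
  · ext b
    simpa [lift] using hbal (some b) j

/-- **Tverberg's theorem.**  Given nonnegative integers `m` and `f` and a family
`y : Fin N → (Fin m → ℝ)` of at least `(m+1)*f + 1` points of `ℝ^m`, the index set
can be partitioned into `f+1` nonempty parts (encoded by a surjective labelling
`P : Fin N → Fin (f+1)`) such that the convex hulls of the images of the parts
have a common point. -/
theorem tverberg (m f N : ℕ) (hN : (m + 1) * f + 1 ≤ N) (y : Fin N → (Fin m → ℝ)) :
    ∃ P : Fin N → Fin (f + 1), Function.Surjective P ∧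
      (⋂ i : Fin (f + 1), convexHull ℝ (y '' (P ⁻¹' {i}))).Nonempty := by
  obtain ⟨g, w, hw, hw1, hmass, hmoment⟩ :=
    exists_balanced_weights m f (by simpa using hN) y
  set W := ∑ k with g k = Fin.last f, w k
  have hWpos : 0 < W := by
    have htotal : (f + 1 : ℝ) * W = 1 := by
      rw [← Finset.sum_fiberwise Finset.univ g w, Finset.sum_congr rfl fun j _ => hmass j,
        Finset.sum_const, Finset.card_univ, Fintype.card_fin, nsmul_eq_mul] at hw1
      exact_mod_cast hw1
    by_contra! hle
    nlinarith [(Nat.cast_nonneg f : (0 : ℝ) ≤ f)]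
  have hmem : ∀ j, (Finset.univ.filter fun k => g k = Fin.last f).centerMass w y ∈
      convexHull ℝ (y '' (g ⁻¹' {j})) := fun j => by
    have heq : (Finset.univ.filter fun k => g k = Fin.last f).centerMass w y =
        (Finset.univ.filter fun k => g k = j).centerMass w y := by
      rw [Finset.centerMass, Finset.centerMass, hmass j, hmoment j]
    rw [heq]
    refine Finset.centerMass_mem_convexHull _ (fun k _ => hw k) (hmass j ▸ hWpos) fun k hk => ?_
    exact ⟨k, by simpa using hk, rfl⟩
  refine ⟨g, fun j => ?_, _, Set.mem_iInter.2 hmem⟩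
  obtain ⟨_, k, hk, -⟩ := convexHull_nonempty_iff.1 ⟨_, hmem j⟩
  exact ⟨k, hk⟩
end

section
/- Lower bound on the limiting weights via a source component: under the matrix-sequence setup, for every r ≥ 1, letting π(r) be the stochastic vector with lim_{t→∞} Φ(t,r) = 𝟙 π(r)ᵀ, there exists a graph H ∈ C with source component S_H such that π_i(r) ≥ β^{χ·n} for every i ∈ S_H; in particular the set {i : π_i(r) ≥ β^{χ·n}} contains a source component of some member of C, whose size is at least γ = min_{H∈C} |S_H|. -/
open Finset Filter

/-- A matrix is row-stochastic: nonnegative entries, each row sums to 1. -/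
def RowStochastic {n : ℕ} (M : Matrix (Fin n) (Fin n) ℝ) : Prop :=
  (∀ i j, 0 ≤ M i j) ∧ ∀ i, ∑ j, M i j = 1

/-- A vector is stochastic: nonnegative entries summing to 1. -/
def StochasticVec {n : ℕ} (π : Fin n → ℝ) : Prop :=
  (∀ j, 0 ≤ π j) ∧ ∑ j, π j = 1

/-- `S` is a strongly connected component of the digraph `G` on `Fin n`. -/
def IsSCC {n : ℕ} (G : Fin n → Fin n → Prop) (S : Set (Fin n)) : Prop :=
  S.Nonempty ∧
  (∀ i ∈ S, ∀ j ∈ S, Relation.ReflTransGen G i j) ∧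
  (∀ i ∈ S, ∀ j, Relation.ReflTransGen G i j → Relation.ReflTransGen G j i → j ∈ S)

/-- `S` is a source component of `G`: a strongly connected component with no
incoming edges from outside. -/
def IsSourceComponent {n : ℕ} (G : Fin n → Fin n → Prop) (S : Set (Fin n)) : Prop :=
  IsSCC G S ∧ ∀ i ∉ S, ∀ j ∈ S, ¬ G i j

/-- Backward product `Φ(t,r) = A[t] A[t-1] ⋯ A[r]` (the identity when `t < r`,
in particular `Φ(t,t+1) = I`). -/
def bprod {n : ℕ} (A : ℕ → Matrix (Fin n) (Fin n) ℝ) (t r : ℕ) :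
    Matrix (Fin n) (Fin n) ℝ :=
  (((List.range (t + 1 - r)).map fun k => A (t - k))).prod

/-- A path that leaves a set `R` uses an edge that leaves `R`. -/
theorem Relation.ReflTransGen.exists_exit_edge {V : Type*} {G : V → V → Prop} {R : Set V} {a b : V}
    (hab : Relation.ReflTransGen G a b) (ha : a ∈ R) (hb : b ∉ R) :
    ∃ c ∈ R, ∃ d ∉ R, G c d := by
  induction hab with
  | refl => exact absurd ha hb
  | @tail c d _ hcd ih =>
    by_cases hc : c ∈ R
    · exact ⟨c, hc, d, hb, hcd⟩
    · exact ih hc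

/-- Every vertex of a finite digraph can be reached from some source component. -/
theorem exists_isSourceComponent_reaching {n : ℕ} (G : Fin n → Fin n → Prop) (v : Fin n) :
    ∃ S, IsSourceComponent G S ∧ ∃ u ∈ S, Relation.ReflTransGen G u v := by
  classical
  let anc : Fin n → Finset (Fin n) := fun u => univ.filter fun w => Relation.ReflTransGen G w u
  obtain ⟨u, hu, hmin⟩ := (anc v).exists_min_image (fun u => (anc u).card)
    ⟨v, by simp [anc, Relation.ReflTransGen.refl]⟩
  have huv : Relation.ReflTransGen G u v := by simpa [anc] using hu
  have hback : ∀ w, Relation.ReflTransGen G w u → Relation.ReflTransGen G u w := by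
    intro w hw
    have hsub : anc w ⊆ anc u := fun x hx => by
      simp only [anc, mem_filter, mem_univ, true_and] at hx ⊢
      exact hx.trans hw
    have heq := Finset.eq_of_subset_of_card_le hsub
      (hmin w (by simpa [anc] using hw.trans huv))
    have hmem : u ∈ anc u := by simp [anc, Relation.ReflTransGen.refl]
    rw [← heq] at hmem
    simpa [anc] using hmem
  refine ⟨{w | Relation.ReflTransGen G w u}, ⟨⟨⟨u, .refl⟩, ?_, ?_⟩, ?_⟩, u, .refl, huv⟩
  · exact fun i hi j hj => hi.trans (hback j hj)
  · exact fun i hi j _ hji => hji.trans hi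
  · exact fun i hi j hj hij => hi (.head hij hj)

/-- The vertices of a unique source component reach every vertex. -/
theorem IsSourceComponent.reaches {n : ℕ} {G : Fin n → Fin n → Prop} {S : Set (Fin n)}
    (hS : IsSourceComponent G S) (hunique : ∃! S, IsSourceComponent G S) {i : Fin n} (hi : i ∈ S)
    (v : Fin n) : Relation.ReflTransGen G i v := by
  obtain ⟨T, hT, u, hu, huv⟩ := exists_isSourceComponent_reaching G v
  obtain rfl := hunique.unique hS hT
  exact (hS.1.2.1 i hi u hu).trans huv

theorem bprod_of_lt {n : ℕ} (A : ℕ → Matrix (Fin n) (Fin n) ℝ) {t r : ℕ} (h : t < r) :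
    bprod A t r = 1 := by
  simp [bprod, Nat.sub_eq_zero_of_le (Nat.succ_le_of_lt h)]

theorem bprod_succ {n : ℕ} (A : ℕ → Matrix (Fin n) (Fin n) ℝ) {t r : ℕ} (h : r ≤ t + 1) :
    bprod A (t + 1) r = A (t + 1) * bprod A t r := by
  unfold bprod
  rw [show t + 1 + 1 - r = (t + 1 - r) + 1 by omega, List.range_succ_eq_map, List.map_cons,
    List.prod_cons, List.map_map]
  congr 3
  funext k
  simp [Function.comp]

/-- Averaging by a row-stochastic matrix preserves lower bounds. -/
theorem RowStochastic.le_mulVec {n : ℕ} {M : Matrix (Fin n) (Fin n) ℝ} (hM : RowStochastic M)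
    {x : Fin n → ℝ} {c : ℝ} (hx : ∀ l, c ≤ x l) (l : Fin n) : c ≤ ∑ j, M l j * x j := by
  calc c = ∑ j, M l j * c := by rw [← Finset.sum_mul, hM.2, one_mul]
    _ ≤ _ := Finset.sum_le_sum fun j _ => mul_le_mul_of_nonneg_left (hx j) (hM.1 l j)

/-- Let `x` evolve by row-stochastic matrices whose entries along the edges of the graph selected
at each step are at least `β`. If `x 0` is at least `1` at a vertex reaching all others in a graph
`C k` that is selected at least `n` times before step `m`, then `x m` is at least `β ^ m`. -/
theorem pow_le_of_card_selected {n : ℕ} {β : ℝ} (hβ : 0 < β) {ι : Type*} [DecidableEq ι]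
    {C : ι → Fin n → Fin n → Prop} (hloop : ∀ k i, C k i i)
    {B : ℕ → Matrix (Fin n) (Fin n) ℝ} (hB : ∀ s, RowStochastic (B s))
    {κ : ℕ → ι} (hκ : ∀ s i j, C (κ s) j i → β ≤ B s i j)
    {x : ℕ → Fin n → ℝ} (hx0 : ∀ l, 0 ≤ x 0 l)
    (hx : ∀ s l, x (s + 1) l = ∑ j, B s l j * x s j)
    {i : Fin n} (hi : 1 ≤ x 0 i) {k : ι} (hreach : ∀ v, Relation.ReflTransGen (C k) i v)
    {m : ℕ} (hm : n ≤ ((Finset.range m).filter fun s => κ s = k).card) (l : Fin n) :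
    β ^ m ≤ x m l := by
  classical
  have hnonneg : ∀ s l, 0 ≤ x s l := by
    intro s
    induction s with
    | zero => exact hx0
    | succ s ih =>
      intro l
      rw [hx]
      exact (hB s).le_mulVec ih l
  let R : ℕ → Finset (Fin n) := fun s => univ.filter fun l => β ^ s ≤ x s l
  have hedge : ∀ s a b, a ∈ R s → C (κ s) a b → b ∈ R (s + 1) := by
    intro s a b ha hab
    simp only [R, mem_filter, mem_univ, true_and] at ha ⊢
    calc β ^ (s + 1) = β * β ^ s := pow_succ' β s
      _ ≤ B s b a * x s a := mul_le_mul (hκ s b a hab) ha (by positivity) ((hB s).1 b a)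
      _ ≤ ∑ j, B s b j * x s j := Finset.single_le_sum
          (fun j _ => mul_nonneg ((hB s).1 b j) (hnonneg s j)) (mem_univ a)
      _ = x (s + 1) b := (hx s b).symm
  have hmono : ∀ s, R s ⊆ R (s + 1) := fun s a ha => hedge s a a ha (hloop _ a)
  have hmem : ∀ s, i ∈ R s := by
    intro s
    induction s with
    | zero => simpa [R] using hi
    | succ s ih => exact hmono s ih
  have hgrow : ∀ s, R s = univ ∨ ((Finset.range s).filter fun s => κ s = k).card < (R s).card := by
    intro s
    induction s with
    | zero => exact .inr (by simpa using Finset.card_pos.mpr ⟨i, hmem 0⟩)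
    | succ s ih =>
      rcases ih with h | h
      · exact .inl (Finset.univ_subset_iff.mp (h ▸ hmono s))
      · rw [Finset.range_add_one, Finset.filter_insert]
        split_ifs with hk
        · by_cases hfull : R s = univ
          · exact .inl (Finset.univ_subset_iff.mp (hfull ▸ hmono s))
          obtain ⟨v, hv⟩ : ∃ v, v ∉ R s := by
            by_contra! hall
            exact hfull (Finset.eq_univ_iff_forall.mpr hall)
          obtain ⟨c, hc, d, hd, hcd⟩ :=
            (hreach v).exists_exit_edge (R := (R s : Set (Fin n))) (hmem s) hv
          have hlt : (R s).card < (R (s + 1)).card := Finset.card_lt_card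
            ⟨hmono s, fun hsub => hd (hsub (hedge s c d hc (hk ▸ hcd)))⟩
          rw [Finset.card_insert_of_notMem (by simp)]
          exact .inr (by omega)
        · exact .inr (h.trans_le (Finset.card_le_card (hmono s)))
  have huniv : R m = univ := by
    refine (hgrow m).resolve_right fun h => ?_
    have := (R m).card_le_univ
    rw [Fintype.card_fin] at this
    omega
  have hl : l ∈ R m := huniv ▸ mem_univ l
  simpa [R] using hl

/-- **Lower bound on the limiting weights via a source component.**  Under the
matrix-sequence setup, if `Φ(t,r) → 𝟙 π(r)ᵀ`, then for every `r ≥ 1` there is a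
graph `H ∈ C` and a source component `S` of `H` with `π_i(r) ≥ β^(χ n)` for all
`i ∈ S`; in particular `S ⊆ {i : π_i(r) ≥ β^(χ n)}` and `|S| ≥ γ`, where `γ` is
any lower bound on the sizes of source components of members of `C`. -/
theorem limiting_weights_source_lower_bound
    {n : ℕ} (hn : 1 ≤ n)
    (β : ℝ) (hβ : 0 < β) (hβ1 : β ≤ 1)
    {ι : Type} [Fintype ι] [Nonempty ι]
    (C : ι → (Fin n → Fin n → Prop))
    (hloop : ∀ k i, C k i i)
    (hsource : ∀ k, ∃! S : Set (Fin n), IsSourceComponent (C k) S)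
    (χ ν : ℕ) (hχ : χ = Fintype.card ι) (hν : ν = χ * n)
    (A : ℕ → Matrix (Fin n) (Fin n) ℝ)
    (hA : ∀ t, RowStochastic (A t))
    (hdom : ∀ t, 1 ≤ t → ∃ k : ι, ∀ i j, C k j i → β ≤ A t i j)
    (π : ℕ → Fin n → ℝ)
    (hπ : ∀ r, 1 ≤ r → StochasticVec (π r))
    (hlim : ∀ r, 1 ≤ r → ∀ i j,
      Tendsto (fun t => bprod A t r i j) atTop (nhds (π r j)))
    (γ : ℕ)
    (hγ : ∀ k : ι, ∀ S : Set (Fin n), IsSourceComponent (C k) S → γ ≤ S.ncard) :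
    ∀ r, 1 ≤ r → ∃ (k : ι) (S : Set (Fin n)), IsSourceComponent (C k) S ∧
      (∀ i ∈ S, β ^ (χ * n) ≤ π r i) ∧
      S ⊆ {i : Fin n | β ^ (χ * n) ≤ π r i} ∧ γ ≤ S.ncard := by
  classical
  subst hχ
  intro r hr
  choose κ hκ using fun s => hdom (r + s) (by omega)
  obtain ⟨k, -, hk⟩ := Finset.exists_le_card_fiber_of_mul_le_card_of_maps_to
    (s := Finset.range (Fintype.card ι * n)) (t := (univ : Finset ι)) (f := κ) (n := n)
    (fun _ _ => mem_univ _) univ_nonempty (by simp)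
  obtain ⟨S, hS, -⟩ := id (hsource k)
  have hbound : ∀ i ∈ S, β ^ (Fintype.card ι * n) ≤ π r i := by
    intro i hi
    let x : ℕ → Fin n → ℝ := fun s l => bprod A (r - 1 + s) r l i
    have hx : ∀ s l, x (s + 1) l = ∑ j, A (r + s) l j * x s j := by
      intro s l
      simp only [x]
      rw [← add_assoc, bprod_succ A (by omega), Matrix.mul_apply,
        show r - 1 + s + 1 = r + s by omega]
    have hx0 : ∀ l, x 0 l = (1 : Matrix (Fin n) (Fin n) ℝ) l i := by
      intro l
      simp only [x]
      rw [bprod_of_lt A (by omega)]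
    have hwindow : ∀ l, β ^ (Fintype.card ι * n) ≤ x (Fintype.card ι * n) l :=
      pow_le_of_card_selected hβ hloop (fun s => hA (r + s)) hκ
        (fun l => by rw [hx0, Matrix.one_apply]; split_ifs <;> norm_num) hx
        (by simp [hx0]) (hS.reaches (hsource k) hi) hk
    have hafter : ∀ s ≥ Fintype.card ι * n, ∀ l, β ^ (Fintype.card ι * n) ≤ x s l := by
      intro s hs
      induction s, hs using Nat.le_induction with
      | base => exact hwindow
      | succ s _ ih =>
        intro l
        rw [hx]
        exact (hA (r + s)).le_mulVec ih l
    refine ge_of_tendsto (hlim r hr i i) ?_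
    filter_upwards [eventually_ge_atTop (r - 1 + Fintype.card ι * n)] with t ht
    have := hafter (t - (r - 1)) (by omega) i
    simp only [x] at this
    rwa [show r - 1 + (t - (r - 1)) = t by omega] at this
  exact ⟨k, S, hS, hbound, hbound, hγ k S hS⟩
end

section
/- Deterministic bound on the products-minus-limit term (inequality (lt1) in the paper's proof of Lemma 2): Let n ≥ 1 and ν ≥ 1 be integers, C0 ≥ 0 and λ ∈ (0,1) reals. Suppose reals Φ_{ij}(t,r+1), π_j(r+1) (for 1 ≤ r ≤ t, 1 ≤ i, j ≤ n) and x^j_k (for j ∈ {1,…,n}, k ≥ 1) satisfy |Φ_{ij}(t,r+1) − π_j(r+1)| ≤ λ^{⌈(t−r)/ν⌉} and |x^j_k| ≤ C0. Then for every i and every t ≥ 1, (1/t²) · | Σ_{r=1}^t Σ_{j=1}^n (Φ_{ij}(t,r+1) − π_j(r+1)) Σ_{k=1}^r x^j_k | ≤ n C0 / ( (1−λ)(1−λ^{1/ν}) t ). -/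
open Finset

/-- Ceiling division `⌈a / b⌉` for natural numbers. -/
def ceilDiv (a b : ℕ) : ℕ := (a + b - 1) / b

theorem le_mul_ceilDiv (a : ℕ) {b : ℕ} (hb : 1 ≤ b) : a ≤ b * ceilDiv a b := by
  have hdiv := Nat.div_add_mod (a + b - 1) b
  have hmod := Nat.mod_lt (a + b - 1) hb
  unfold ceilDiv
  omega

theorem sum_Icc_pow_sub_le {q : ℝ} (hq0 : 0 ≤ q) (hq1 : q < 1) (t : ℕ) :
    ∑ r ∈ Finset.Icc 1 t, q ^ (t - r) ≤ 1 / (1 - q) := by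
  have hreflect : ∑ r ∈ Finset.Icc 1 t, q ^ (t - r) = ∑ m ∈ Finset.range t, q ^ m := by
    refine Finset.sum_bij' (fun r _ => t - r) (fun m _ => t - m) ?_ ?_ ?_ ?_ ?_ <;>
      simp only [Finset.mem_Icc, Finset.mem_range, implies_true] <;> intros <;> omega
  rw [hreflect, le_div_iff₀ (by linarith), geom_sum_mul_neg]
  linarith [pow_nonneg hq0 t]

theorem abs_sum_Icc_one_le {f : ℕ → ℝ} {C : ℝ} (hf : ∀ k, 1 ≤ k → |f k| ≤ C) (r : ℕ) :
    |∑ k ∈ Finset.Icc 1 r, f k| ≤ r * C := by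
  calc |∑ k ∈ Finset.Icc 1 r, f k| ≤ ∑ k ∈ Finset.Icc 1 r, |f k| :=
        Finset.abs_sum_le_sum_abs _ _
    _ ≤ ∑ _k ∈ Finset.Icc 1 r, C :=
        Finset.sum_le_sum fun k hk => hf k (Finset.mem_Icc.mp hk).1
    _ = r * C := by simp

/-- **Deterministic bound on the products-minus-limit term** (inequality (lt1)
in the paper's proof of Lemma 2).  If `|Φ_{ij}(t,r+1) − π_j(r+1)| ≤ λ^⌈(t−r)/ν⌉`
and `|x^j_k| ≤ C0`, then
`(1/t²)|Σ_{r=1}^t Σ_j (Φ_{ij}(t,r+1) − π_j(r+1)) Σ_{k=1}^r x^j_k|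
  ≤ n C0 / ((1−λ)(1−λ^{1/ν}) t)`. -/
theorem products_minus_limit_bound
    {n ν : ℕ} (hn : 1 ≤ n) (hν : 1 ≤ ν)
    (C0 : ℝ) (hC0 : 0 ≤ C0)
    (lam : ℝ) (hlam : lam ∈ Set.Ioo (0 : ℝ) 1)
    (Φ : ℕ → ℕ → Fin n → Fin n → ℝ) (π : ℕ → Fin n → ℝ)
    (hΦ : ∀ t r, 1 ≤ r → r ≤ t → ∀ i j,
      |Φ t (r + 1) i j - π (r + 1) j| ≤ lam ^ ceilDiv (t - r) ν)
    (x : Fin n → ℕ → ℝ) (hx : ∀ j k, 1 ≤ k → |x j k| ≤ C0) :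
    ∀ (i : Fin n) (t : ℕ), 1 ≤ t →
      (1 / (t : ℝ) ^ 2) *
        |∑ r ∈ Finset.Icc 1 t, ∑ j,
          (Φ t (r + 1) i j - π (r + 1) j) * ∑ k ∈ Finset.Icc 1 r, x j k|
      ≤ n * C0 / ((1 - lam) * (1 - lam ^ ((1 : ℝ) / ν)) * t) := by
  intro i t ht
  obtain ⟨hlam0, hlam1⟩ := hlam
  have hν0 : (0 : ℝ) < ν := by exact_mod_cast hν
  have ht0 : (0 : ℝ) < t := by exact_mod_cast ht
  set q : ℝ := lam ^ ((1 : ℝ) / ν) with hq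
  have hq0 : 0 < q := Real.rpow_pos_of_pos hlam0 _
  have hq1 : q < 1 := Real.rpow_lt_one hlam0.le hlam1 (by positivity)
  have hqν : q ^ ν = lam := by
    rw [hq, one_div, Real.rpow_inv_natCast_pow hlam0.le (by omega)]
  have hterm : ∀ r ∈ Finset.Icc 1 t, ∀ j,
      |(Φ t (r + 1) i j - π (r + 1) j) * ∑ k ∈ Finset.Icc 1 r, x j k|
        ≤ q ^ (t - r) * (t * C0) := by
    intro r hr j
    obtain ⟨hr1, hrt⟩ := Finset.mem_Icc.mp hr
    have hweight : |Φ t (r + 1) i j - π (r + 1) j| ≤ q ^ (t - r) := by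
      refine (hΦ t r hr1 hrt i j).trans ?_
      rw [← hqν, ← pow_mul]
      exact pow_le_pow_of_le_one hq0.le hq1.le (le_mul_ceilDiv _ hν)
    have hpartial : |∑ k ∈ Finset.Icc 1 r, x j k| ≤ t * C0 :=
      (abs_sum_Icc_one_le (hx j) r).trans (by gcongr)
    rw [abs_mul]
    gcongr
  have hsum : |∑ r ∈ Finset.Icc 1 t, ∑ j,
      (Φ t (r + 1) i j - π (r + 1) j) * ∑ k ∈ Finset.Icc 1 r, x j k|
        ≤ 1 / (1 - q) * (n * (t * C0)) := by
    calc _ ≤ ∑ r ∈ Finset.Icc 1 t, ∑ _j : Fin n, q ^ (t - r) * (t * C0) :=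
          (Finset.abs_sum_le_sum_abs _ _).trans <| Finset.sum_le_sum fun r hr =>
            (Finset.abs_sum_le_sum_abs _ _).trans <| Finset.sum_le_sum fun j _ => hterm r hr j
      _ = (∑ r ∈ Finset.Icc 1 t, q ^ (t - r)) * (n * (t * C0)) := by
          rw [Finset.sum_mul]
          refine Finset.sum_congr rfl fun r _ => ?_
          simp only [Finset.sum_const, Finset.card_univ, Fintype.card_fin, nsmul_eq_mul]
          ring
      _ ≤ _ := by
          gcongr
          exact sum_Icc_pow_sub_le hq0.le hq1 t
  have hlam' : 0 < 1 - lam := by linarith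
  have hq' : 0 < 1 - q := by linarith
  calc _ ≤ 1 / (t : ℝ) ^ 2 * (1 / (1 - q) * (n * (t * C0))) := by gcongr
    _ = n * C0 / (1 * (1 - q) * t) := by field_simp
    _ ≤ _ := by
        gcongr
        linarith
end
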